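/- Variance bound for weighted partial sums along a geometrically ergodic Markov chain (Lemma on the median, part (i)). Suppose (𝒦, ν, c₁, ρ) satisfies the U_d-geometric-ergodicity bound for d = 1 and for d = 2, and set K' := ∫ (1+‖w'‖)² dν(w'). Let L > 0 and let h : 𝒲 → ℝ^{d_ξ} be measurable with ‖h(w')‖ ≤ L(1+‖w'‖) for all w' ∈ 𝒲 and ∫ h dν = 0. Let (W_t)_{t≥0} be a Markov process with kernel 𝒦 started at w ∈ 𝒲. Then for every integer n ≥ 1, every β̄ > 0, and all real weights b₁, …, b_n with 0 ≤ b_l ≤ β̄ for each l: E[ ‖ Σ_{l=1}^{n} b_l·h(W_l) ‖² ] ≤ (4L²c₁·β̄²/(1−ρ))·( n·K' + (2c₁/(1−ρ))·(1+‖w‖²) ). (In the paper this is the bound E[‖S*_{j,m₁} − S*_{j,m₂}‖² | W_{m₂}] ≤ (4L²c₁β_{I_j}²/(1−ρ))((m₁−m₂)K_{d_U} + (2c₁/(1−ρ))(1+‖W_{m₂}‖²)) for the partial sums S*_{j,m} = Σ_{l=I_j}^{m−1} β_l H(W_l, ξ*), with h = H(·, ξ*) and β̄ = β_{I_j} ≥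 β_l.) -/

import Mathlib

open MeasureTheory ProbabilityTheory Filter
open scoped RealInnerProductSpace

noncomputable section

/-- Euclidean state space. -/
abbrev Wsp (dW : ℕ) : Type := EuclideanSpace ℝ (Fin dW)

/-- `t`-step iterate of a Markov kernel. -/
noncomputable def kiter {α : Type*} [MeasurableSpace α] (K : Kernel α α) : ℕ → Kernel α α :=
  fun t => Nat.rec (motive := fun _ => Kernel α α) Kernel.id (fun _ ih => ih.comp K) t

instance kiter_isMarkovKernel {α : Type*} [MeasurableSpace α] (K : Kernel α α)
    [IsMarkovKernel K] (t : ℕ) : IsMarkovKernel (kiter K t) := by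
  induction t with
  | zero => exact inferInstanceAs (IsMarkovKernel (Kernel.id))
  | succ n ih => exact inferInstanceAs (IsMarkovKernel ((kiter K n).comp K))

/-- U_d geometric ergodicity bound. -/
def UdBound {dW : ℕ} (K : Kernel (Wsp dW) (Wsp dW)) [IsMarkovKernel K]
    (ν : Measure (Wsp dW)) [IsProbabilityMeasure ν] (c₁ ρ d : ℝ) : Prop :=
  Integrable (fun w' => (1 : ℝ) + ‖w'‖ ^ d) ν ∧
  ∀ (t : ℕ) (w : Wsp dW) (f : Wsp dW → ℝ), Measurable f →
    (∀ w', |f w'| ≤ 1 + ‖w'‖ ^ d) →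
      (∫ w', |f w'|
          ∂((((kiter K t) w).toSignedMeasure - ν.toSignedMeasure).totalVariation))
        ≤ c₁ * ρ ^ t * (1 + ‖w‖ ^ d)

/-- Markov process with kernel `K` started at `w`. -/
structure IsMarkovProc {dW : ℕ} {Ω : Type*} [MeasurableSpace Ω]
    (K : Kernel (Wsp dW) (Wsp dW)) (P : Measure Ω)
    (Wp : ℕ → Ω → Wsp dW) (w : Wsp dW) : Prop where
  meas : ∀ t, Measurable (Wp t)
  init : ∀ᵐ ω ∂P, Wp 0 ω = w
  markov : ∀ (t : ℕ) (f : Wsp dW → ℝ), Measurable f → (∃ C, ∀ x, |f x| ≤ C) →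
    (P[(fun ω => f (Wp (t+1) ω)) |
        ⨆ s ∈ Finset.range (t+1), MeasurableSpace.comap (Wp s) inferInstance])
      =ᵐ[P] fun ω => ∫ x, f x ∂(K (Wp t ω))


section TotalVariation

variable {α : Type*} [MeasurableSpace α]

/-- The Jordan decomposition of a difference of finite measures, as an identity of measures. -/
lemma exists_add_eq_add_totalVariation (μ ν : Measure α) [IsFiniteMeasure μ] [IsFiniteMeasure ν] :
    ∃ p q : Measure α, μ + q = ν + p ∧
      p + q = (μ.toSignedMeasure - ν.toSignedMeasure).totalVariation := by
  set s := μ.toSignedMeasure - ν.toSignedMeasure with hs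
  refine ⟨s.toJordanDecomposition.posPart, s.toJordanDecomposition.negPart, ?_, rfl⟩
  have h1 := SignedMeasure.toSignedMeasure_toJordanDecomposition s
  rw [JordanDecomposition.toSignedMeasure, hs, sub_eq_sub_iff_add_eq_add, ← hs] at h1
  rw [← Measure.toSignedMeasure_eq_toSignedMeasure_iff, Measure.toSignedMeasure_add,
    Measure.toSignedMeasure_add, ← h1, add_comm]

lemma integrable_and_abs_integral_sub_le_totalVariation (μ ν : Measure α) [IsFiniteMeasure μ]
    [IsFiniteMeasure ν] {f : α → ℝ} (hfν : Integrable f ν)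
    (hf : Integrable f (μ.toSignedMeasure - ν.toSignedMeasure).totalVariation) :
    Integrable f μ ∧ |(∫ x, f x ∂μ) - ∫ x, f x ∂ν| ≤
      ∫ x, |f x| ∂(μ.toSignedMeasure - ν.toSignedMeasure).totalVariation := by
  obtain ⟨p, q, hpq, htv⟩ := exists_add_eq_add_totalVariation μ ν
  rw [← htv] at hf ⊢
  have hp : Integrable f p := hf.mono_measure (Measure.le_add_right le_rfl)
  have hq : Integrable f q := hf.mono_measure (Measure.le_add_left le_rfl)
  have hμ : Integrable f μ :=
    (hpq ▸ hfν.add_measure hp : Integrable f (μ + q)).mono_measure (Measure.le_add_right le_rfl)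
  refine ⟨hμ, ?_⟩
  have h1 : (∫ x, f x ∂μ) + ∫ x, f x ∂q = (∫ x, f x ∂ν) + ∫ x, f x ∂p := by
    rw [← integral_add_measure hμ hq, ← integral_add_measure hfν hp, hpq]
  rw [integral_add_measure hp.abs hq.abs]
  calc |(∫ x, f x ∂μ) - ∫ x, f x ∂ν| = |(∫ x, f x ∂p) - ∫ x, f x ∂q| := by
        congr 1; linarith
    _ ≤ |∫ x, f x ∂p| + |∫ x, f x ∂q| := abs_sub _ _
    _ ≤ _ := add_le_add abs_integral_le_integral_abs abs_integral_le_integral_abs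

/-- A nonnegative function whose truncations have uniformly bounded integrals is integrable. -/
lemma integrable_and_integral_le_of_truncation (τ : Measure α) [IsFiniteMeasure τ] {g : α → ℝ}
    (hg : Measurable g) (hg0 : ∀ x, 0 ≤ g x) {C : ℝ} (hC : 0 ≤ C)
    (hb : ∀ N : ℕ, ∫ x, min (g x) N ∂τ ≤ C) :
    Integrable g τ ∧ ∫ x, g x ∂τ ≤ C := by
  have hlim : ∫⁻ x, ENNReal.ofReal (g x) ∂τ ≤ ENNReal.ofReal C := by
    have heq : ∀ x, ENNReal.ofReal (g x) = ⨆ N : ℕ, ENNReal.ofReal (min (g x) N) := by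
      intro x
      refine le_antisymm ?_ (iSup_le fun N => ENNReal.ofReal_le_ofReal (min_le_left _ _))
      obtain ⟨N, hN⟩ := exists_nat_ge (g x)
      exact le_iSup_of_le N (by rw [min_eq_left hN])
    simp_rw [heq]
    rw [lintegral_iSup (fun N => (hg.min measurable_const).ennreal_ofReal)
      (fun N M hNM x => ENNReal.ofReal_le_ofReal
        (min_le_min le_rfl (by exact_mod_cast hNM)))]
    refine iSup_le fun N => ?_
    have h0 : ∀ x, 0 ≤ min (g x) N := fun x => le_min (hg0 x) N.cast_nonneg
    rw [← ofReal_integral_eq_lintegral_ofReal _ (Eventually.of_forall h0)]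
    · exact ENNReal.ofReal_le_ofReal (hb N)
    · refine Integrable.of_bound (hg.min measurable_const).aestronglyMeasurable N
        (Eventually.of_forall fun x => ?_)
      rw [Real.norm_of_nonneg (h0 x)]
      exact min_le_right _ _
  constructor
  · refine ⟨hg.aestronglyMeasurable, ?_⟩
    rw [hasFiniteIntegral_iff_ofReal (Eventually.of_forall hg0)]
    exact hlim.trans_lt ENNReal.ofReal_lt_top
  · rw [integral_eq_lintegral_of_nonneg_ae (Eventually.of_forall hg0) hg.aestronglyMeasurable]
    exact ENNReal.toReal_le_of_le_ofReal hC hlim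

end TotalVariation

section GeometricErgodicity

variable {dW : ℕ} {K : Kernel (Wsp dW) (Wsp dW)} [IsMarkovKernel K]
  {ν : Measure (Wsp dW)} [IsProbabilityMeasure ν] {c₁ ρ d : ℝ}

lemma UdBound.integrable_and_abs_sub_le (hU : UdBound K ν c₁ ρ d) (hc₁ : 0 ≤ c₁) (hρ₀ : 0 ≤ ρ)
    (t : ℕ) (w : Wsp dW) {f : Wsp dW → ℝ} (hf : Measurable f)
    (hfb : ∀ w', |f w'| ≤ 1 + ‖w'‖ ^ d) :
    Integrable f (kiter K t w) ∧
      |(∫ x, f x ∂(kiter K t w)) - ∫ x, f x ∂ν| ≤ c₁ * ρ ^ t * (1 + ‖w‖ ^ d) := by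
  have hmeas : Measurable fun w' : Wsp dW => 1 + ‖w'‖ ^ d := by fun_prop
  have hnn : ∀ w' : Wsp dW, 0 ≤ 1 + ‖w'‖ ^ d := fun w' => by positivity
  have : IsFiniteMeasure
      ((kiter K t w).toSignedMeasure - ν.toSignedMeasure).totalVariation := by
    unfold SignedMeasure.totalVariation; infer_instance
  have htv := (integrable_and_integral_le_of_truncation
    ((kiter K t w).toSignedMeasure - ν.toSignedMeasure).totalVariation hmeas hnn
    (C := c₁ * ρ ^ t * (1 + ‖w‖ ^ d)) (by positivity) fun N => by
      have h0 : ∀ x : Wsp dW, 0 ≤ min (1 + ‖x‖ ^ d) N := fun x => le_min (hnn x) N.cast_nonneg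
      have := hU.2 t w (fun x => min (1 + ‖x‖ ^ d) N) (hmeas.min measurable_const)
        fun x => by rw [abs_of_nonneg (h0 x)]; exact min_le_left _ _
      simpa only [abs_of_nonneg (h0 _)] using this).1
  have hfν : Integrable f ν := hU.1.mono' hf.aestronglyMeasurable (Eventually.of_forall hfb)
  have hftv := htv.mono' hf.aestronglyMeasurable (Eventually.of_forall hfb)
  have key := integrable_and_abs_integral_sub_le_totalVariation (kiter K t w) ν hfν hftv
  exact ⟨key.1, key.2.trans (hU.2 t w f hf hfb)⟩

lemma UdBound.secondMoment_le (hU : UdBound K ν c₁ ρ 2) (hc₁ : 0 ≤ c₁) (hρ₀ : 0 ≤ ρ)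
    (t : ℕ) (w : Wsp dW) :
    Integrable (fun x => (1 + ‖x‖) ^ 2) (kiter K t w) ∧
      ∫ x, (1 + ‖x‖) ^ 2 ∂(kiter K t w) ≤
        (∫ x, (1 + ‖x‖) ^ 2 ∂ν) + 2 * c₁ * ρ ^ t * (1 + ‖w‖ ^ 2) := by
  obtain ⟨hi, hb⟩ := hU.integrable_and_abs_sub_le hc₁ hρ₀ t w
    (f := fun x => 2⁻¹ * (1 + ‖x‖) ^ 2) (by fun_prop) (fun x => by
      rw [abs_of_nonneg (by positivity), Real.rpow_two]
      nlinarith [sq_nonneg (1 - ‖x‖)])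
  refine ⟨?_, ?_⟩
  · simpa [← mul_assoc] using hi.const_mul 2
  · rw [integral_const_mul, integral_const_mul, Real.rpow_two] at hb
    have := (abs_le.1 hb).2
    linarith

variable {E : Type*} [NormedAddCommGroup E] [InnerProductSpace ℝ E] [CompleteSpace E]
  [MeasurableSpace E] [BorelSpace E] [SecondCountableTopology E]

lemma UdBound.abs_integral_inner_le (hU : UdBound K ν c₁ ρ 1) (hc₁ : 0 ≤ c₁) (hρ₀ : 0 ≤ ρ)
    {L : ℝ} (hL : 0 < L) {h : Wsp dW → E} (hmeas : Measurable h)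
    (hgrow : ∀ w', ‖h w'‖ ≤ L * (1 + ‖w'‖)) (hmean : ∫ w', h w' ∂ν = 0)
    (t : ℕ) (w : Wsp dW) (e : E) :
    |∫ x, ⟪e, h x⟫ ∂(kiter K t w)| ≤ L * ‖e‖ * (c₁ * ρ ^ t * (1 + ‖w‖)) := by
  rcases eq_or_ne e 0 with rfl | he
  · simp
  have hpos : 0 < L * ‖e‖ := by positivity
  obtain ⟨-, hb⟩ := hU.integrable_and_abs_sub_le hc₁ hρ₀ t w
    (f := fun x => (L * ‖e‖)⁻¹ * ⟪e, h x⟫) ((measurable_const.inner hmeas).const_mul _)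
    (fun x => by
      rw [abs_mul, abs_of_pos (inv_pos.2 hpos), Real.rpow_one, inv_mul_le_iff₀ hpos]
      calc |⟪e, h x⟫| ≤ ‖e‖ * ‖h x‖ := abs_real_inner_le_norm _ _
        _ ≤ ‖e‖ * (L * (1 + ‖x‖)) := by gcongr; exact hgrow x
        _ = _ := by ring)
  have hhν : Integrable h ν := by
    refine (hU.1.const_mul L).mono' hmeas.aestronglyMeasurable (Eventually.of_forall fun x => ?_)
    simpa using hgrow x
  rwa [integral_const_mul, integral_const_mul, integral_inner hhν, hmean, inner_zero_right,
    mul_zero, sub_zero, abs_mul, abs_of_pos (inv_pos.2 hpos), inv_mul_le_iff₀ hpos,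
    Real.rpow_one] at hb

end GeometricErgodicity

section MarkovProcess

variable {dW : ℕ} {Ω : Type*} [MeasurableSpace Ω] {K : Kernel (Wsp dW) (Wsp dW)}
  [IsMarkovKernel K] {P : Measure Ω} [IsProbabilityMeasure P] {Wp : ℕ → Ω → Wsp dW} {w : Wsp dW}

omit [IsMarkovKernel K] [IsProbabilityMeasure P] in
lemma IsMarkovProc.iSup_comap_le (hMP : IsMarkovProc K P Wp w) (t : ℕ) :
    ⨆ s ∈ Finset.range (t + 1), MeasurableSpace.comap (Wp s) inferInstance ≤
      (inferInstance : MeasurableSpace Ω) :=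
  iSup₂_le fun s _ => (hMP.meas s).comap_le

/-- One-step Markov property on an event of the past. -/
lemma IsMarkovProc.map_restrict_succ (hMP : IsMarkovProc K P Wp w) (t : ℕ) {A : Set Ω}
    (hA : MeasurableSet[⨆ s ∈ Finset.range (t + 1),
      MeasurableSpace.comap (Wp s) inferInstance] A) :
    (P.restrict A).map (Wp (t + 1)) = K ∘ₘ (P.restrict A).map (Wp t) := by
  have hle := hMP.iSup_comap_le t
  ext B hB
  have hind : Measurable (B.indicator (1 : Wsp dW → ℝ)) := measurable_one.indicator hB
  have hbd : ∀ x, |B.indicator (1 : Wsp dW → ℝ) x| ≤ 1 := fun x => by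
    by_cases hx : x ∈ B <;> simp [hx]
  have hce := hMP.markov t (B.indicator 1) hind ⟨1, hbd⟩
  have hint : Integrable (fun ω => B.indicator (1 : Wsp dW → ℝ) (Wp (t + 1) ω)) P :=
    Integrable.of_bound (hind.comp (hMP.meas _)).aestronglyMeasurable 1
      (Eventually.of_forall fun ω => hbd _)
  have h1 := setIntegral_condExp hle hint hA
  rw [setIntegral_congr_ae (hle A hA) (hce.mono fun ω hω _ => hω)] at h1
  simp_rw [integral_indicator_one hB] at h1
  have hcomp : (fun ω => B.indicator (1 : Wsp dW → ℝ) (Wp (t + 1) ω)) =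
      (Wp (t + 1) ⁻¹' B).indicator 1 := rfl
  rw [hcomp, integral_indicator_one (hMP.meas _ hB)] at h1
  rw [Measure.map_apply (hMP.meas _) hB, Measure.bind_apply hB K.aemeasurable,
    lintegral_map (K.measurable_coe hB) (hMP.meas t),
    ← ENNReal.toReal_eq_toReal_iff' (measure_ne_top _ _), ← measureReal_def, ← h1,
    integral_eq_lintegral_of_nonneg_ae (Eventually.of_forall fun _ => measureReal_nonneg)]
  · simp [measureReal_def]
  · exact ((K.measurable_coe hB).comp (hMP.meas t)).ennreal_toReal.aestronglyMeasurable
  · refine (lt_of_le_of_lt (lintegral_mono fun ω => prob_le_one) ?_).ne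
    simp

lemma IsMarkovProc.map_restrict_add (hMP : IsMarkovProc K P Wp w) (t l : ℕ) {A : Set Ω}
    (hA : MeasurableSet[⨆ s ∈ Finset.range (l + 1),
      MeasurableSpace.comap (Wp s) inferInstance] A) :
    (P.restrict A).map (Wp (l + t)) = kiter K t ∘ₘ (P.restrict A).map (Wp l) := by
  induction t generalizing l with
  | zero => exact (Measure.id_comp).symm
  | succ t ih =>
    have hmono : (⨆ s ∈ Finset.range (l + 1),
        MeasurableSpace.comap (Wp s) (inferInstance : MeasurableSpace (Wsp dW))) ≤
        ⨆ s ∈ Finset.range (l + 1 + 1), MeasurableSpace.comap (Wp s) inferInstance :=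
      biSup_mono fun s hs => Finset.mem_range.2 ((Finset.mem_range.1 hs).trans (Nat.lt_succ_self _))
    rw [show l + (t + 1) = l + 1 + t by ring, ih (l + 1) (hmono A hA),
      hMP.map_restrict_succ l hA, Measure.comp_assoc]
    rfl

lemma IsMarkovProc.map_eq_kiter (hMP : IsMarkovProc K P Wp w) (t : ℕ) :
    P.map (Wp t) = kiter K t w := by
  have h1 := hMP.map_restrict_add t 0 (A := Set.univ) MeasurableSet.univ
  have h0 : P.map (Wp 0) = Measure.dirac w := by
    rw [Measure.map_congr (g := fun _ => w) hMP.init]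
    simp
  rw [Measure.restrict_univ, h0, zero_add] at h1
  rw [h1, Measure.dirac_bind (kiter K t).measurable]

lemma IsMarkovProc.map_prodMk (hMP : IsMarkovProc K P Wp w) (l t : ℕ) :
    P.map (fun ω => (Wp l ω, Wp (l + t) ω)) = kiter K l w ⊗ₘ kiter K t := by
  have hm : Measurable fun ω => (Wp l ω, Wp (l + t) ω) := (hMP.meas _).prodMk (hMP.meas _)
  have : IsProbabilityMeasure (P.map (fun ω => (Wp l ω, Wp (l + t) ω))) :=
    Measure.isProbabilityMeasure_map hm.aemeasurable
  refine Measure.ext_prod fun {B C} hB hC => ?_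
  have hA : MeasurableSet[⨆ s ∈ Finset.range (l + 1),
      MeasurableSpace.comap (Wp s) (inferInstance : MeasurableSpace (Wsp dW))] (Wp l ⁻¹' B) :=
    le_biSup (fun s => MeasurableSpace.comap (Wp s) (inferInstance : MeasurableSpace (Wsp dW)))
      (Finset.self_mem_range_succ l) _ ⟨B, hB, rfl⟩
  have h1 := congrArg (fun m => m C) (hMP.map_restrict_add t l hA)
  rw [Measure.map_apply (hMP.meas _) hC, Measure.restrict_apply (hMP.meas _ hC),
    ← Measure.restrict_map (hMP.meas l) hB, hMP.map_eq_kiter,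
    Measure.bind_apply hC (kiter K t).aemeasurable] at h1
  rw [Measure.compProd_apply_prod hB hC, ← h1, Measure.map_apply hm (hB.prod hC), Set.inter_comm]
  rfl

variable {E : Type*} [NormedAddCommGroup E] [InnerProductSpace ℝ E] [CompleteSpace E]
  [MeasurableSpace E] [BorelSpace E] [SecondCountableTopology E]
  {ν : Measure (Wsp dW)} [IsProbabilityMeasure ν] {c₁ ρ L : ℝ} {h : Wsp dW → E}

omit [CompleteSpace E] in
lemma IsMarkovProc.integrable_inner (hMP : IsMarkovProc K P Wp w) (hU2 : UdBound K ν c₁ ρ 2)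
    (hc₁ : 0 ≤ c₁) (hρ₀ : 0 ≤ ρ) (hmeas : Measurable h)
    (hgrow : ∀ w', ‖h w'‖ ≤ L * (1 + ‖w'‖)) (l m : ℕ) :
    Integrable (fun ω => ⟪h (Wp l ω), h (Wp m ω)⟫) P := by
  have hsq : ∀ k, Integrable (fun ω => (1 + ‖Wp k ω‖) ^ 2) P := fun k => by
    have := (hU2.secondMoment_le hc₁ hρ₀ k w).1
    rw [← hMP.map_eq_kiter] at this
    exact this.comp_measurable (hMP.meas k)
  refine (((hsq l).add (hsq m)).const_mul (L ^ 2)).mono'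
    ((hmeas.comp (hMP.meas l)).inner (hmeas.comp (hMP.meas m))).aestronglyMeasurable
    (Eventually.of_forall fun ω => ?_)
  have hl := pow_le_pow_left₀ (norm_nonneg _) (hgrow (Wp l ω)) 2
  have hm := pow_le_pow_left₀ (norm_nonneg _) (hgrow (Wp m ω)) 2
  have hi := norm_inner_le_norm (𝕜 := ℝ) (h (Wp l ω)) (h (Wp m ω))
  simp only [Pi.add_apply]
  nlinarith [sq_nonneg (‖h (Wp l ω)‖ - ‖h (Wp m ω)‖), sq_nonneg ‖h (Wp l ω)‖,
    sq_nonneg ‖h (Wp m ω)‖]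

/-- Geometric decay of covariances along the chain. -/
lemma IsMarkovProc.abs_integral_inner_le (hMP : IsMarkovProc K P Wp w)
    (hU1 : UdBound K ν c₁ ρ 1) (hU2 : UdBound K ν c₁ ρ 2) (hc₁ : 0 ≤ c₁) (hρ₀ : 0 ≤ ρ)
    (hL : 0 < L) (hmeas : Measurable h) (hgrow : ∀ w', ‖h w'‖ ≤ L * (1 + ‖w'‖))
    (hmean : ∫ w', h w' ∂ν = 0) (l t : ℕ) :
    |∫ ω, ⟪h (Wp l ω), h (Wp (l + t) ω)⟫ ∂P| ≤
      L ^ 2 * c₁ * ρ ^ t *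
        ((∫ x, (1 + ‖x‖) ^ 2 ∂ν) + 2 * c₁ * ρ ^ l * (1 + ‖w‖ ^ 2)) := by
  have hm : Measurable fun ω => (Wp l ω, Wp (l + t) ω) := (hMP.meas _).prodMk (hMP.meas _)
  have hF : Measurable fun z : Wsp dW × Wsp dW => ⟪h z.1, h z.2⟫ :=
    (hmeas.comp measurable_fst).inner (hmeas.comp measurable_snd)
  have hint : Integrable (fun z : Wsp dW × Wsp dW => ⟪h z.1, h z.2⟫)
      (kiter K l w ⊗ₘ kiter K t) := by
    rw [← hMP.map_prodMk, integrable_map_measure hF.aestronglyMeasurable hm.aemeasurable]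
    exact hMP.integrable_inner hU2 hc₁ hρ₀ hmeas hgrow l (l + t)
  have heq : ∫ ω, ⟪h (Wp l ω), h (Wp (l + t) ω)⟫ ∂P =
      ∫ x, ∫ y, ⟪h x, h y⟫ ∂(kiter K t x) ∂(kiter K l w) := by
    rw [← Measure.integral_compProd hint, ← hMP.map_prodMk,
      integral_map hm.aemeasurable hF.aestronglyMeasurable]
  obtain ⟨hi, hb⟩ := hU2.secondMoment_le hc₁ hρ₀ l w
  rw [heq]
  calc |∫ x, ∫ y, ⟪h x, h y⟫ ∂(kiter K t x) ∂(kiter K l w)|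
      ≤ ∫ x, L ^ 2 * c₁ * ρ ^ t * (1 + ‖x‖) ^ 2 ∂(kiter K l w) := by
        rw [← Real.norm_eq_abs]
        refine norm_integral_le_of_norm_le (hi.const_mul _) (Eventually.of_forall fun x => ?_)
        rw [Real.norm_eq_abs]
        calc |∫ y, ⟪h x, h y⟫ ∂(kiter K t x)|
            ≤ L * ‖h x‖ * (c₁ * ρ ^ t * (1 + ‖x‖)) :=
              hU1.abs_integral_inner_le hc₁ hρ₀ hL hmeas hgrow hmean t x (h x)
          _ ≤ L * (L * (1 + ‖x‖)) * (c₁ * ρ ^ t * (1 + ‖x‖)) := by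
              gcongr; exact hgrow x
          _ = _ := by ring
    _ = L ^ 2 * c₁ * ρ ^ t * ∫ x, (1 + ‖x‖) ^ 2 ∂(kiter K l w) := integral_const_mul _ _
    _ ≤ _ := by gcongr

end MarkovProcess

lemma sum_pow_le_inv_one_sub {ρ : ℝ} (hρ₀ : 0 ≤ ρ) (hρ₁ : ρ < 1) (s : Finset ℕ) :
    ∑ k ∈ s, ρ ^ k ≤ (1 - ρ)⁻¹ := by
  rw [← tsum_geometric_of_lt_one hρ₀ hρ₁]
  exact (summable_geometric_of_lt_one hρ₀ hρ₁).sum_le_tsum s fun _ _ => by positivity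

/-- A symmetric array with geometric decay away from the diagonal has absolute sum controlled by
its diagonal bounds. -/
lemma sum_abs_le_of_geometric_decay {a : ℕ → ℕ → ℝ} {M : ℕ → ℝ} {C ρ : ℝ}
    (hρ₀ : 0 ≤ ρ) (hρ₁ : ρ < 1) (hC : 0 ≤ C) (hM : ∀ l, 0 ≤ M l)
    (hsymm : ∀ l m, a l m = a m l) (ha : ∀ l t, |a l (l + t)| ≤ C * ρ ^ t * M l)
    (s : Finset ℕ) :
    ∑ l ∈ s, ∑ m ∈ s, |a l m| ≤ 2 * C / (1 - ρ) * ∑ l ∈ s, M l := by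
  set g : ℕ → ℕ → ℝ := fun l m => C * M l * if l ≤ m then ρ ^ (m - l) else 0 with hg
  have hg0 : ∀ l m, 0 ≤ g l m := fun l m => by
    have := hM l
    simp only [hg]; positivity
  have hle : ∀ l m, l ≤ m → |a l m| ≤ g l m := fun l m hlm => by
    obtain ⟨t, rfl⟩ := Nat.exists_eq_add_of_le hlm
    simp only [hg, if_pos hlm, Nat.add_sub_cancel_left]
    exact (ha l t).trans_eq (by ring)
  have hag : ∀ l m, |a l m| ≤ g l m + g m l := fun l m => by
    rcases le_total l m with hlm | hlm
    · linarith [hle l m hlm, hg0 m l]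
    · rw [hsymm]
      linarith [hle m l hlm, hg0 l m]
  have hrow : ∀ l, ∑ m ∈ s, g l m ≤ C * M l * (1 - ρ)⁻¹ := fun l => by
    rw [← Finset.mul_sum, ← Finset.sum_filter]
    refine mul_le_mul_of_nonneg_left ?_ (mul_nonneg hC (hM l))
    rw [← Finset.sum_image (f := fun k => ρ ^ k) (g := fun m => m - l)]
    · exact sum_pow_le_inv_one_sub hρ₀ hρ₁ _
    · intro x hx y hy hxy
      simp only [Finset.coe_filter, Set.mem_ofPred_eq] at hx hy
      simp only at hxy
      lia
  calc ∑ l ∈ s, ∑ m ∈ s, |a l m| ≤ ∑ l ∈ s, ∑ m ∈ s, (g l m + g m l) :=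
        Finset.sum_le_sum fun l _ => Finset.sum_le_sum fun m _ => hag l m
    _ = 2 * ∑ l ∈ s, ∑ m ∈ s, g l m := by
        simp_rw [Finset.sum_add_distrib]
        rw [Finset.sum_comm (f := fun l m => g m l), two_mul]
    _ ≤ 2 * ∑ l ∈ s, C * M l * (1 - ρ)⁻¹ := by
        gcongr with l; exact hrow l
    _ = _ := by
        rw [← Finset.sum_mul, ← Finset.mul_sum, div_eq_mul_inv]; ring

/-- Variance bound for weighted partial sums along a geometrically ergodic Markov chain. -/
theorem weighted_partial_sum_variance_bound
    {dW dX : ℕ} {Ω : Type*} [MeasurableSpace Ω]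
    (K : Kernel (Wsp dW) (Wsp dW)) [IsMarkovKernel K]
    (ν : Measure (Wsp dW)) [IsProbabilityMeasure ν]
    (hstat : ν.bind (⇑K) = ν)
    (c₁ ρ : ℝ) (hc₁ : 0 < c₁) (hρ₀ : 0 ≤ ρ) (hρ₁ : ρ < 1)
    (hU1 : UdBound K ν c₁ ρ 1) (hU2 : UdBound K ν c₁ ρ 2)
    (L : ℝ) (hL : 0 < L)
    (h : Wsp dW → EuclideanSpace ℝ (Fin dX))
    (hmeas : Measurable h)
    (hgrow : ∀ w', ‖h w'‖ ≤ L * (1 + ‖w'‖))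
    (hmean : (∫ w', h w' ∂ν) = 0)
    (P : Measure Ω) [IsProbabilityMeasure P]
    (Wp : ℕ → Ω → Wsp dW) (w : Wsp dW)
    (hMP : IsMarkovProc K P Wp w) :
    ∀ n : ℕ, 1 ≤ n → ∀ βbar : ℝ, 0 < βbar → ∀ b : ℕ → ℝ,
      (∀ l ∈ Finset.Icc 1 n, 0 ≤ b l ∧ b l ≤ βbar) →
      (∫ ω, ‖∑ l ∈ Finset.Icc 1 n, b l • h (Wp l ω)‖ ^ 2 ∂P)
        ≤ (4 * L ^ 2 * c₁ * βbar ^ 2 / (1 - ρ)) *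
            ((n : ℝ) * (∫ w', (1 + ‖w'‖) ^ 2 ∂ν) +
              (2 * c₁ / (1 - ρ)) * (1 + ‖w‖ ^ 2)) := by
  intro n _ βbar hβ b hb
  have hρ : 0 < 1 - ρ := sub_pos.2 hρ₁
  set K' := ∫ w', (1 + ‖w'‖) ^ 2 ∂ν with hK'
  have hK'0 : 0 ≤ K' := integral_nonneg fun _ => by positivity
  set D := 1 + ‖w‖ ^ 2 with hD
  have hD0 : 0 ≤ D := by positivity
  set a : ℕ → ℕ → ℝ := fun l m => ∫ ω, ⟪h (Wp l ω), h (Wp m ω)⟫ ∂P with ha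
  have hint := hMP.integrable_inner hU2 hc₁.le hρ₀ hmeas hgrow
  have hexp : (∫ ω, ‖∑ l ∈ Finset.Icc 1 n, b l • h (Wp l ω)‖ ^ 2 ∂P) =
      ∑ l ∈ Finset.Icc 1 n, ∑ m ∈ Finset.Icc 1 n, b l * b m * a l m := by
    simp_rw [← real_inner_self_eq_norm_sq, sum_inner, inner_sum, real_inner_smul_left,
      real_inner_smul_right, ← mul_assoc]
    rw [integral_finsetSum _ fun l _ => integrable_finsetSum _ fun m _ => (hint l m).const_mul _]
    refine Finset.sum_congr rfl fun l _ => ?_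
    rw [integral_finsetSum _ fun m _ => (hint l m).const_mul _]
    exact Finset.sum_congr rfl fun m _ => integral_const_mul _ _
  have hsum := sum_abs_le_of_geometric_decay (a := a)
    (M := fun l => K' + 2 * c₁ * ρ ^ l * D) (C := L ^ 2 * c₁) hρ₀ hρ₁ (by positivity)
    (fun l => by positivity) (fun l m => by simp only [ha, real_inner_comm])
    (hMP.abs_integral_inner_le hU1 hU2 hc₁.le hρ₀ hL hmeas hgrow hmean) (Finset.Icc 1 n)
  have hMsum : ∑ l ∈ Finset.Icc 1 n, (K' + 2 * c₁ * ρ ^ l * D) ≤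
      n * K' + 2 * c₁ / (1 - ρ) * D := by
    rw [Finset.sum_add_distrib, ← Finset.sum_mul, ← Finset.mul_sum, Finset.sum_const,
      Nat.card_Icc, Nat.add_sub_cancel, nsmul_eq_mul, div_eq_mul_inv]
    gcongr
    exact sum_pow_le_inv_one_sub hρ₀ hρ₁ _
  rw [hexp]
  calc ∑ l ∈ Finset.Icc 1 n, ∑ m ∈ Finset.Icc 1 n, b l * b m * a l m
      ≤ ∑ l ∈ Finset.Icc 1 n, ∑ m ∈ Finset.Icc 1 n, βbar ^ 2 * |a l m| := by
        refine Finset.sum_le_sum fun l hl => Finset.sum_le_sum fun m hm => ?_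
        obtain ⟨hl0, hl1⟩ := hb l hl
        obtain ⟨hm0, hm1⟩ := hb m hm
        calc b l * b m * a l m ≤ b l * b m * |a l m| := by gcongr; exact le_abs_self _
          _ ≤ βbar * βbar * |a l m| := by gcongr
          _ = _ := by ring
    _ = βbar ^ 2 * ∑ l ∈ Finset.Icc 1 n, ∑ m ∈ Finset.Icc 1 n, |a l m| := by
        simp_rw [Finset.mul_sum]
    _ ≤ βbar ^ 2 * (2 * (L ^ 2 * c₁) / (1 - ρ) * (n * K' + 2 * c₁ / (1 - ρ) * D)) := by
        gcongr
        exact hsum.trans (by gcongr)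
    _ = 2 * L ^ 2 * c₁ * βbar ^ 2 / (1 - ρ) * (n * K' + 2 * c₁ / (1 - ρ) * D) := by ring
    _ ≤ _ := by gcongr; norm_num

end
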